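/- Let S be an inverse semigroup and N a normal inverse subsemigroup of S. For idempotents e, f ∈ E(S), e ≃_N f if and only if e and f are Green's J-related in N, i.e. if and only if there exist m, n ∈ N with m⁻¹ m = e, m m⁻¹ ≤ f, n⁻¹ n = f, and n n⁻¹ ≤ e. -/

import Mathlib

/-- An inverse semigroup: a semigroup in which every element `s` has a
(unique) inverse `s⁻¹` with `s * s⁻¹ * s = s` and `s⁻¹ * s * s⁻¹ = s⁻¹`. -/
class InverseSemigroup (S : Type*) extends Semigroup S, Inv S where
  mul_inv_mul : ∀ s : S, s * s⁻¹ * s = s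
  inv_mul_inv : ∀ s : S, s⁻¹ * s * s⁻¹ = s⁻¹
  inv_unique : ∀ s t : S, s * t * s = s → t * s * t = t → t = s⁻¹

/-- The natural partial order on an inverse semigroup:
`s ≤ t` iff `s = e * t` for some idempotent `e`. -/
def NatLe {S : Type*} [InverseSemigroup S] (s t : S) : Prop :=
  ∃ e : S, IsIdempotentElem e ∧ s = e * t

/-- A normal inverse subsemigroup: a full inverse subsemigroup that is
closed under conjugation. -/
structure IsNormalInverseSubsemigroup {S : Type*} [InverseSemigroup S] (N : Set S) : Prop where
  mul_mem : ∀ {a b : S}, a ∈ N → b ∈ N → a * b ∈ N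
  inv_mem : ∀ {a : S}, a ∈ N → a⁻¹ ∈ N
  full : ∀ {e : S}, IsIdempotentElem e → e ∈ N
  conj_mem : ∀ (s : S) {n : S}, n ∈ N → s⁻¹ * n * s ∈ N

/-- The preorder `≤_N` associated to a normal inverse subsemigroup `N`:
`s ≤_N t` iff there are `a, b ∈ N` with `a⁻¹ * a = s * s⁻¹`,
`s⁻¹ * s = b * b⁻¹` (so `a · s · b` is a trace product) and `a * s * b ≤ t`. -/
def LeN {S : Type*} [InverseSemigroup S] (N : Set S) (s t : S) : Prop :=
  ∃ a ∈ N, ∃ b ∈ N, a⁻¹ * a = s * s⁻¹ ∧ s⁻¹ * s = b * b⁻¹ ∧ NatLe (a * s * b) t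

/-- The equivalence `≃_N` obtained by symmetrizing `≤_N`. -/
def SimeqN {S : Type*} [InverseSemigroup S] (N : Set S) (s t : S) : Prop :=
  LeN N s t ∧ LeN N t s

namespace InverseSemigroup

variable {S : Type*} [InverseSemigroup S]

theorem inv_inv_eq (s : S) : s⁻¹⁻¹ = s :=
  (inv_unique s⁻¹ s (inv_mul_inv s) (mul_inv_mul s)).symm

theorem inv_eq_of_isIdempotentElem {e : S} (he : IsIdempotentElem e) : e⁻¹ = e :=
  (inv_unique e e (by rw [he.eq, he.eq]) (by rw [he.eq, he.eq])).symm

theorem isIdempotentElem_mul_inv (s : S) : IsIdempotentElem (s * s⁻¹) := by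
  rw [IsIdempotentElem, ← mul_assoc, mul_inv_mul]

theorem isIdempotentElem_mul {e f : S} (he : IsIdempotentElem e) (hf : IsIdempotentElem f) :
    IsIdempotentElem (e * f) := by
  have hx := inv_mul_inv (e * f)
  have hef := mul_inv_mul (e * f)
  have hfxe : f * (e * f)⁻¹ * e = (e * f)⁻¹ := by
    apply inv_unique
    · calc e * f * (f * (e * f)⁻¹ * e) * (e * f)
          = e * (f * f) * (e * f)⁻¹ * ((e * e) * f) := by simp only [mul_assoc]
        _ = e * f := by rw [he.eq, hf.eq, hef]
    · calc f * (e * f)⁻¹ * e * (e * f) * (f * (e * f)⁻¹ * e)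
          = f * ((e * f)⁻¹ * ((e * e) * (f * f)) * (e * f)⁻¹) * e := by
            simp only [mul_assoc]
        _ = f * (e * f)⁻¹ * e := by rw [he.eq, hf.eq, hx]
  have hidem : IsIdempotentElem (e * f)⁻¹ := by
    calc (e * f)⁻¹ * (e * f)⁻¹
        = (f * (e * f)⁻¹ * e) * (f * (e * f)⁻¹ * e) := by rw [hfxe]
      _ = f * ((e * f)⁻¹ * (e * f) * (e * f)⁻¹) * e := by simp only [mul_assoc]
      _ = (e * f)⁻¹ := by rw [hx, hfxe]
  have h := inv_eq_of_isIdempotentElem hidem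
  rw [inv_inv_eq] at h
  rwa [← h] at hidem

theorem mul_comm_of_isIdempotentElem {e f : S} (he : IsIdempotentElem e)
    (hf : IsIdempotentElem f) : e * f = f * e := by
  have key : ∀ {a b : S}, IsIdempotentElem a → IsIdempotentElem b →
      a * b * (b * a) * (a * b) = a * b := by
    intro a b ha hb
    calc a * b * (b * a) * (a * b) = a * (b * b) * ((a * a) * b) := by simp only [mul_assoc]
      _ = a * b := by rw [ha.eq, hb.eq, (isIdempotentElem_mul ha hb).eq]
  rw [inv_unique (e * f) (f * e) (key he hf) (key hf he),
    inv_eq_of_isIdempotentElem (isIdempotentElem_mul he hf)]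

/-- If `a⁻¹ * a = b * b⁻¹` and `a * b` is idempotent, then `a * b = a * a⁻¹`. -/
theorem mul_eq_mul_inv_of_isIdempotentElem {a b : S} (hab : a⁻¹ * a = b * b⁻¹)
    (hk : IsIdempotentElem (a * b)) : a * b = a * a⁻¹ := by
  have ha : a * b * b⁻¹ = a := by rw [mul_assoc, ← hab, ← mul_assoc, mul_inv_mul]
  have hka : a * b * a = a := by
    calc a * b * a = (a * b) * (a * b * b⁻¹) := by rw [ha]
      _ = (a * b) * (a * b) * b⁻¹ := by simp only [mul_assoc]
      _ = a := by rw [hk.eq, ha]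
  calc a * b = a * a⁻¹ * (a * b) := by rw [← mul_assoc, mul_inv_mul]
    _ = a * b * (a * a⁻¹) := mul_comm_of_isIdempotentElem (isIdempotentElem_mul_inv a) hk
    _ = a * a⁻¹ := by rw [← mul_assoc, hka]

end InverseSemigroup

open InverseSemigroup in
/-- For idempotents, `e ≤_N f` iff `e` is the domain of an element of `N` with range below `f`. -/
theorem leN_iff_of_isIdempotentElem {S : Type*} [InverseSemigroup S] {N : Set S}
    (hN : IsNormalInverseSubsemigroup N) {e f : S}
    (he : IsIdempotentElem e) (hf : IsIdempotentElem f) :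
    LeN N e f ↔ ∃ m ∈ N, m⁻¹ * m = e ∧ NatLe (m * m⁻¹) f := by
  have mul_dom : ∀ {a : S}, a⁻¹ * a = e → a * e = a := by
    rintro a rfl
    rw [← mul_assoc, mul_inv_mul]
  simp only [LeN, inv_eq_of_isIdempotentElem he, he.eq]
  constructor
  · rintro ⟨a, ha, b, -, hae, heb, g, hg, hab⟩
    rw [mul_dom hae] at hab
    refine ⟨a, ha, hae, g, hg, ?_⟩
    rw [← hab, mul_eq_mul_inv_of_isIdempotentElem (hae.trans heb)]
    exact hab ▸ isIdempotentElem_mul hg hf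
  · rintro ⟨m, hm, hme, hle⟩
    refine ⟨m, hm, m⁻¹, hN.inv_mem hm, hme, ?_, ?_⟩
    · rw [inv_inv_eq, hme]
    · rwa [mul_dom hme]

/-- On idempotents, `≃_N` coincides with Green's `J`-relation induced by `N`. -/
theorem simeqN_iff_JN_on_idempotents {S : Type*} [InverseSemigroup S] {N : Set S}
    (hN : IsNormalInverseSubsemigroup N) {e f : S}
    (he : IsIdempotentElem e) (hf : IsIdempotentElem f) :
    SimeqN N e f ↔
      ∃ m ∈ N, ∃ n ∈ N,
        m⁻¹ * m = e ∧ NatLe (m * m⁻¹) f ∧ n⁻¹ * n = f ∧ NatLe (n * n⁻¹) e := by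
  rw [SimeqN, leN_iff_of_isIdempotentElem hN he hf, leN_iff_of_isIdempotentElem hN hf he]
  constructor
  · rintro ⟨⟨m, hm, hme, hmf⟩, n, hn, hnf, hne⟩
    exact ⟨m, hm, n, hn, hme, hmf, hnf, hne⟩
  · rintro ⟨m, hm, n, hn, hme, hmf, hnf, hne⟩
    exact ⟨⟨m, hm, hme, hmf⟩, n, hn, hnf, hne⟩
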